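/- Let ρ_ABC be a density matrix on ℂ^{d_A} ⊗ ℂ^{d_B} ⊗ ℂ^{d_C} with reduced states ρ_A, ρ_B, ρ_AB. Then I(A:B|C) ≥ S(ρ_A) + S(ρ_B) − 2 S(ρ_AB) = I(A:B) − S(ρ_AB), where I(A:B) = S(ρ_A) + S(ρ_B) − S(ρ_AB) is the mutual information of ρ_AB. -/

import Mathlib

open scoped Kronecker ComplexOrder

/-- Von Neumann entropy (natural logarithm) of a matrix, via its eigenvalues
(`0` if the matrix is not Hermitian; `Real.log 0 = 0` handles zero eigenvalues). -/
noncomputable def vN {n : Type*} [Fintype n] [DecidableEq n] (ρ : Matrix n n ℂ) : ℝ :=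
  if h : ρ.IsHermitian then -∑ i, h.eigenvalues i * Real.log (h.eigenvalues i) else 0

/-- Partial trace over the second tensor factor. -/
noncomputable def ptraceB {A B : Type*} [Fintype B] (ρ : Matrix (A × B) (A × B) ℂ) :
    Matrix A A ℂ := Matrix.of fun a a' => ∑ b, ρ (a, b) (a', b)

/-- Partial trace over the first tensor factor. -/
noncomputable def ptraceA {A B : Type*} [Fintype A] (ρ : Matrix (A × B) (A × B) ℂ) :
    Matrix B B ℂ := Matrix.of fun b b' => ∑ a, ρ (a, b) (a, b')

/-- Partial trace over the third factor of a tripartite system `A × B × C`. -/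
noncomputable def ptraceC3 {A B C : Type*} [Fintype C] (ρ : Matrix (A × B × C) (A × B × C) ℂ) :
    Matrix (A × B) (A × B) ℂ := Matrix.of fun x y => ∑ c, ρ (x.1, x.2, c) (y.1, y.2, c)

/-- Partial trace over the second factor of a tripartite system `A × B × C`. -/
noncomputable def ptraceB3 {A B C : Type*} [Fintype B] (ρ : Matrix (A × B × C) (A × B × C) ℂ) :
    Matrix (A × C) (A × C) ℂ := Matrix.of fun x y => ∑ b, ρ (x.1, b, x.2) (y.1, b, y.2)

/-- Conditional mutual information `I(A:B|C) = S(ρ_AC) + S(ρ_BC) − S(ρ_ABC) − S(ρ_C)`. -/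
noncomputable def condMutualInfo {A B C : Type*} [Fintype A] [DecidableEq A] [Fintype B]
    [DecidableEq B] [Fintype C] [DecidableEq C]
    (ρ : Matrix (A × B × C) (A × B × C) ℂ) : ℝ :=
  vN (ptraceB3 ρ) + vN (ptraceA ρ) - vN ρ - vN (ptraceA (ptraceA ρ))

/-- Mutual information `I(A:B) = S(ρ_A) + S(ρ_B) − S(ρ_AB)`. -/
noncomputable def mutualInfo {A B : Type*} [Fintype A] [DecidableEq A] [Fintype B] [DecidableEq B]
    (ρ : Matrix (A × B) (A × B) ℂ) : ℝ :=
  vN (ptraceB ρ) + vN (ptraceA ρ) - vN ρ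

open Matrix Filter Topology

/-- Scalar core of the monotonicity of relative entropy: an inequality between all the resolvent
sums `∑ w p² / (q + t p)` integrates to one between the sums `∑ w p (log p - log q)`. -/
lemma sum_mul_log_sub_log_le {ι κ : Type*} [Fintype ι] [Fintype κ]
    (w p q : ι → ℝ) (w' p' q' : κ → ℝ)
    (hp : ∀ i, 0 ≤ p i) (hq : ∀ i, 0 ≤ q i) (hp' : ∀ i, 0 ≤ p' i) (hq' : ∀ i, 0 ≤ q' i)
    (hs : ∀ i, q i = 0 → w i * p i = 0) (hs' : ∀ i, q' i = 0 → w' i * p' i = 0)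
    (htot : ∑ i, w i * p i = ∑ i, w' i * p' i)
    (hres : ∀ t : ℝ, 0 < t →
      ∑ i, w' i * (p' i ^ 2 / (q' i + t * p' i)) ≤ ∑ i, w i * (p i ^ 2 / (q i + t * p i))) :
    ∑ i, w' i * p' i * (Real.log (p' i) - Real.log (q' i)) ≤
      ∑ i, w i * p i * (Real.log (p i) - Real.log (q i)) := by
  have deriv_term : ∀ (a b c t : ℝ), 0 ≤ b → 0 ≤ c → (c = 0 → a * b = 0) → 0 ≤ t →
      HasDerivAt (fun T => a * b * Real.log (c + T * b)) (a * (b ^ 2 / (c + t * b))) t := by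
    intro a b c t hb hc h ht
    rcases hc.eq_or_lt with hc | hc
    · have hab := h hc.symm
      have : a * (b ^ 2 / (c + t * b)) = 0 := by
        rw [pow_two, mul_div_assoc, ← mul_assoc, hab, zero_mul]
      simpa only [hab, zero_mul, this] using hasDerivAt_const t (0 : ℝ)
    · have hpos : c + t * b ≠ 0 := by positivity
      have h1 : HasDerivAt (fun T => c + T * b) b t := by
        simpa using ((hasDerivAt_id t).mul_const b).const_add c
      exact ((h1.log hpos).const_mul (a * b)).congr_deriv (by ring)
  have lim_term : ∀ (a b c : ℝ), 0 ≤ b → 0 ≤ c →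
      Tendsto (fun T => a * b * (Real.log (c + T * b) - Real.log T)) atTop
        (𝓝 (a * b * Real.log b)) := by
    intro a b c hb hc
    rcases hb.eq_or_lt with hb | hb
    · simp [← hb]
    · refine Tendsto.const_mul _ ?_
      have h1 : Tendsto (fun T : ℝ => c / T + b) atTop (𝓝 (0 + b)) :=
        (tendsto_const_nhds.div_atTop tendsto_id).add_const b
      rw [zero_add] at h1
      refine (h1.log hb.ne').congr' ?_
      filter_upwards [eventually_gt_atTop 0] with T hT
      rw [← Real.log_div (by positivity) hT.ne']
      congr 1
      field_simp
  set f : ℝ → ℝ := fun T => ∑ i, w i * p i * Real.log (q i + T * p i) -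
    ∑ i, w' i * p' i * Real.log (q' i + T * p' i) with hf
  have hfd : ∀ t, 0 ≤ t → HasDerivAt f (∑ i, w i * (p i ^ 2 / (q i + t * p i)) -
      ∑ i, w' i * (p' i ^ 2 / (q' i + t * p' i))) t := fun t ht =>
    (HasDerivAt.fun_sum fun i _ => deriv_term _ _ _ t (hp i) (hq i) (hs i) ht).sub
      (HasDerivAt.fun_sum fun i _ => deriv_term _ _ _ t (hp' i) (hq' i) (hs' i) ht)
  have hmono : MonotoneOn f (Set.Ici 0) := by
    refine monotoneOn_of_deriv_nonneg (convex_Ici 0)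
      (fun t ht => (hfd t ht).continuousAt.continuousWithinAt) ?_ ?_
    · intro t ht
      rw [interior_Ici] at ht
      exact (hfd t (le_of_lt ht)).differentiableAt.differentiableWithinAt
    · intro t ht
      rw [interior_Ici] at ht
      rw [(hfd t (le_of_lt ht)).deriv]
      exact sub_nonneg.2 (hres t ht)
  have hlim : Tendsto f atTop (𝓝 (∑ i, w i * p i * Real.log (p i) -
      ∑ i, w' i * p' i * Real.log (p' i))) := by
    refine ((tendsto_finsetSum Finset.univ fun i _ => lim_term (w i) _ _ (hp i) (hq i)).sub
      (tendsto_finsetSum Finset.univ fun i _ => lim_term (w' i) _ _ (hp' i) (hq' i))).congr ?_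
    intro T
    simp only [hf, mul_sub, Finset.sum_sub_distrib, ← Finset.sum_mul, htot]
    ring
  have h0 : f 0 ≤ _ := ge_of_tendsto hlim (by
    filter_upwards [eventually_ge_atTop 0] with T hT
    exact hmono Set.self_mem_Ici hT hT)
  simp only [hf, zero_mul, add_zero] at h0
  simp only [mul_sub, Finset.sum_sub_distrib]
  linarith

/-- The concave quadratic functional whose maximum over `X` is
`⟨√ρ, (Δ + t)⁻¹ √ρ⟩`, with `Δ` the relative modular operator of `σ` and `ρ`. -/
noncomputable def resolventForm {n : Type*} [Fintype n] (t : ℝ) (X ρ σ : Matrix n n ℂ) : ℝ :=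
  2 * (Xᴴ * ρ).trace.re - (Xᴴ * (σ * X)).trace.re - t * (X * ρ * Xᴴ).trace.re

section Resolvent

variable {n : Type*} [Fintype n] [DecidableEq n] {U V ρ σ : Matrix n n ℂ} {p q : n → ℝ}

lemma resolventForm_eq_sum (hU : Uᴴ * U = 1) (hV : Vᴴ * V = 1)
    (hρ : ρ = U * diagonal (fun i => (p i : ℂ)) * Uᴴ)
    (hσ : σ = V * diagonal (fun i => (q i : ℂ)) * Vᴴ) (t : ℝ) (Y : Matrix n n ℂ) :
    resolventForm t (V * Y * Uᴴ) ρ σ = ∑ j, ∑ i,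
      (2 * (star (Y j i) * (Vᴴ * U) j i).re * p i -
        Complex.normSq (Y j i) * (q j + t * p i)) := by
  have hlin : ((V * Y * Uᴴ)ᴴ * ρ).trace = ∑ j, ∑ i, star (Y j i) * (Vᴴ * U) j i * (p i : ℂ) := by
    have : ((V * Y * Uᴴ)ᴴ * ρ) = U * (Yᴴ * ((Vᴴ * U) * diagonal (fun i => (p i : ℂ)))) * Uᴴ := by
      rw [hρ]; simp only [conjTranspose_mul, conjTranspose_conjTranspose, Matrix.mul_assoc]
    rw [this, trace_mul_comm, ← Matrix.mul_assoc, hU, Matrix.one_mul, Finset.sum_comm]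
    simp only [trace, diag, Matrix.mul_apply (M := Yᴴ), mul_diagonal, conjTranspose_apply]
    simp only [_root_.mul_assoc]
  have hquadσ : ((V * Y * Uᴴ)ᴴ * (σ * (V * Y * Uᴴ))).trace =
      ∑ j, ∑ i, (Complex.normSq (Y j i) : ℂ) * (q j : ℂ) := by
    have : ((V * Y * Uᴴ)ᴴ * (σ * (V * Y * Uᴴ))) =
        U * (Yᴴ * ((Vᴴ * V) * diagonal (fun i => (q i : ℂ)) * (Vᴴ * V) * Y)) * Uᴴ := by
      rw [hσ]; simp only [conjTranspose_mul, conjTranspose_conjTranspose, Matrix.mul_assoc]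
    rw [this, trace_mul_comm, ← Matrix.mul_assoc, hU, hV, Matrix.one_mul, Finset.sum_comm]
    simp only [trace, diag, Matrix.mul_apply (M := Yᴴ), Matrix.mul_one, Matrix.one_mul,
      diagonal_mul, conjTranspose_apply, Complex.normSq_eq_conj_mul_self, starRingEnd_apply]
    exact Finset.sum_congr rfl fun _ _ => Finset.sum_congr rfl fun _ _ => by ring
  have hquadρ : ((V * Y * Uᴴ) * ρ * (V * Y * Uᴴ)ᴴ).trace =
      ∑ j, ∑ i, (Complex.normSq (Y j i) : ℂ) * (p i : ℂ) := by
    have : ((V * Y * Uᴴ) * ρ * (V * Y * Uᴴ)ᴴ) =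
        V * (Y * ((Uᴴ * U) * diagonal (fun i => (p i : ℂ)) * (Uᴴ * U) * Yᴴ)) * Vᴴ := by
      rw [hρ]; simp only [conjTranspose_mul, conjTranspose_conjTranspose, Matrix.mul_assoc]
    rw [this, trace_mul_comm, ← Matrix.mul_assoc, hU, hV, Matrix.one_mul]
    simp only [trace, diag, Matrix.mul_apply (M := Y), Matrix.mul_one, Matrix.one_mul,
      diagonal_mul, conjTranspose_apply, Complex.normSq_eq_conj_mul_self, starRingEnd_apply]
    exact Finset.sum_congr rfl fun _ _ => Finset.sum_congr rfl fun _ _ => by ring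
  rw [resolventForm, hlin, hquadσ, hquadρ]
  simp only [Complex.re_sum, Finset.mul_sum, ← Finset.sum_sub_distrib]
  refine Finset.sum_congr rfl fun j _ => Finset.sum_congr rfl fun i _ => ?_
  rw [← Complex.ofReal_mul, ← Complex.ofReal_mul, Complex.ofReal_re, Complex.ofReal_re,
    Complex.re_mul_ofReal]
  ring

lemma resolventForm_le (hU : Uᴴ * U = 1) (hV : Vᴴ * V = 1)
    (hρ : ρ = U * diagonal (fun i => (p i : ℂ)) * Uᴴ)
    (hσ : σ = V * diagonal (fun i => (q i : ℂ)) * Vᴴ)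
    (hp : ∀ i, 0 ≤ p i) (hq : ∀ i, 0 ≤ q i) {t : ℝ} (ht : 0 < t) (X : Matrix n n ℂ) :
    resolventForm t X ρ σ ≤ ∑ j, ∑ i,
      Complex.normSq ((Vᴴ * U) j i) * (p i ^ 2 / (q j + t * p i)) := by
  have hX : X = V * (Vᴴ * X * U) * Uᴴ := by
    have hU' := mul_eq_one_comm.1 hU
    have hV' := mul_eq_one_comm.1 hV
    calc X = (V * Vᴴ) * X * (U * Uᴴ) := by rw [hU', hV', Matrix.one_mul, Matrix.mul_one]
      _ = _ := by simp only [Matrix.mul_assoc]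
  rw [hX, resolventForm_eq_sum hU hV hρ hσ]
  refine Finset.sum_le_sum fun j _ => Finset.sum_le_sum fun i _ => ?_
  generalize (Vᴴ * X * U) j i = y
  generalize (Vᴴ * U) j i = g
  rcases (add_nonneg (hq j) (mul_nonneg ht.le (hp i))).eq_or_lt with h | h
  · have hpi : p i = 0 := by nlinarith [hq j, hp i, mul_nonneg ht.le (hp i)]
    rw [← h, hpi]; simp
  · rw [← sub_nonneg]
    generalize q j + t * p i = s at h ⊢
    have key : Complex.normSq g * (p i ^ 2 / s) -
        (2 * (star y * g).re * p i - Complex.normSq y * s) =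
        ((g.re * p i - y.re * s) ^ 2 + (g.im * p i - y.im * s) ^ 2) / s := by
      field_simp
      simp only [Complex.normSq_apply, Complex.mul_re, Complex.star_def, Complex.conj_re,
        Complex.conj_im]
      ring
    rw [key]
    positivity

lemma exists_resolventForm_eq (hU : Uᴴ * U = 1) (hV : Vᴴ * V = 1)
    (hρ : ρ = U * diagonal (fun i => (p i : ℂ)) * Uᴴ)
    (hσ : σ = V * diagonal (fun i => (q i : ℂ)) * Vᴴ)
    (hp : ∀ i, 0 ≤ p i) (hq : ∀ i, 0 ≤ q i) {t : ℝ} (ht : 0 < t) :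
    ∃ X, resolventForm t X ρ σ = ∑ j, ∑ i,
      Complex.normSq ((Vᴴ * U) j i) * (p i ^ 2 / (q j + t * p i)) := by
  refine ⟨V * (of fun j i => ((p i / (q j + t * p i) : ℝ) : ℂ) * (Vᴴ * U) j i) * Uᴴ, ?_⟩
  rw [resolventForm_eq_sum hU hV hρ hσ]
  refine Finset.sum_congr rfl fun j _ => Finset.sum_congr rfl fun i _ => ?_
  rw [of_apply]
  generalize (Vᴴ * U) j i = g
  rcases (add_nonneg (hq j) (mul_nonneg ht.le (hp i))).eq_or_lt with h | h
  · rw [← h]; simp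
  · generalize q j + t * p i = s at h ⊢
    simp only [Complex.normSq_apply, Complex.mul_re, Complex.mul_im, Complex.star_def,
      Complex.conj_re, Complex.conj_im, Complex.ofReal_re, Complex.ofReal_im]
    field_simp
    ring

end Resolvent

section PartialTrace

variable {A B C : Type*} [Fintype A] [DecidableEq A] [Fintype B] [DecidableEq B] [Fintype C]
  [DecidableEq C]

lemma Matrix.IsHermitian.eq_eigenvectorUnitary_mul {n : Type*} [Fintype n] [DecidableEq n]
    {ρ : Matrix n n ℂ} (h : ρ.IsHermitian) :
    ρ = (h.eigenvectorUnitary : Matrix n n ℂ) * diagonal (fun i => (h.eigenvalues i : ℂ)) *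
      (h.eigenvectorUnitary : Matrix n n ℂ)ᴴ := by
  conv_lhs => rw [h.spectral_theorem]
  rfl

lemma Matrix.IsHermitian.eigenvectorUnitary_conjTranspose_mul {n : Type*} [Fintype n]
    [DecidableEq n] {ρ : Matrix n n ℂ} (h : ρ.IsHermitian) :
    (h.eigenvectorUnitary : Matrix n n ℂ)ᴴ * (h.eigenvectorUnitary : Matrix n n ℂ) = 1 :=
  Unitary.coe_star_mul_self h.eigenvectorUnitary

lemma vN_eq {n : Type*} [Fintype n] [DecidableEq n] {ρ : Matrix n n ℂ} (h : ρ.IsHermitian) :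
    vN ρ = -∑ i, h.eigenvalues i * Real.log (h.eigenvalues i) :=
  dif_pos h

lemma posSemidef_ptraceA {A B : Type*} [Fintype A]
    {ρ : Matrix (A × B) (A × B) ℂ} (h : ρ.PosSemidef) :
    (ptraceA ρ).PosSemidef := by
  have : ptraceA ρ = ∑ a, ρ.submatrix (fun b => (a, b)) (fun b => (a, b)) := by
    ext i j
    simp [ptraceA, Matrix.sum_apply]
  rw [this]
  exact posSemidef_sum _ fun a _ => h.submatrix _

lemma posSemidef_ptraceB3 {A B C : Type*} [Fintype B]
    {ρ : Matrix (A × B × C) (A × B × C) ℂ} (h : ρ.PosSemidef) :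
    (ptraceB3 ρ).PosSemidef := by
  have : ptraceB3 ρ = ∑ b, ρ.submatrix (fun x : A × C => (x.1, b, x.2))
      (fun x : A × C => (x.1, b, x.2)) := by
    ext i j
    simp [ptraceB3, Matrix.sum_apply]
  rw [this]
  exact posSemidef_sum _ fun a _ => h.submatrix _

lemma ptraceA_one_kronecker_mul_mul {A B : Type*} [Fintype A] [DecidableEq A] [Fintype B]
    (M N : Matrix B B ℂ) (ρ : Matrix (A × B) (A × B) ℂ) :
    ptraceA (((1 : Matrix A A ℂ) ⊗ₖ M) * ρ * ((1 : Matrix A A ℂ) ⊗ₖ N)) =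
      M * ptraceA ρ * N := by
  ext b b'
  simp only [ptraceA, of_apply, Matrix.mul_apply, kroneckerMap_apply, one_apply,
    Fintype.sum_prod_type, ite_mul, one_mul, zero_mul, mul_ite, mul_zero, Finset.sum_ite_irrel,
    Finset.sum_const_zero, Finset.sum_ite_eq, Finset.sum_ite_eq', Finset.mem_univ, if_true,
    Finset.mul_sum, Finset.sum_mul]
  rw [Finset.sum_comm]
  refine Finset.sum_congr rfl fun _ _ => ?_
  rw [Finset.sum_comm]

/-- Tensoring with the identity on the middle factor. -/
def liftMiddle (B : Type*) [DecidableEq B] (X : Matrix (A × C) (A × C) ℂ) :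
    Matrix (A × B × C) (A × B × C) ℂ :=
  of fun x y => if x.2.1 = y.2.1 then X (x.1, x.2.2) (y.1, y.2.2) else 0

lemma liftMiddle_mul {A B C : Type*} [Fintype A] [Fintype B] [DecidableEq B] [Fintype C]
    (X Y : Matrix (A × C) (A × C) ℂ) :
    liftMiddle B X * liftMiddle B Y = liftMiddle B (X * Y) := by
  ext ⟨a, b, c⟩ ⟨a', b', c'⟩
  simp only [liftMiddle, of_apply, Matrix.mul_apply, Fintype.sum_prod_type]
  by_cases h : b = b'
  · subst h
    simp [Finset.sum_ite_irrel]
  · simp [h, Finset.sum_ite_irrel]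

lemma liftMiddle_conjTranspose {A B C : Type*} [DecidableEq B]
    (X : Matrix (A × C) (A × C) ℂ) :
    (liftMiddle B X)ᴴ = liftMiddle B Xᴴ := by
  ext ⟨a, b, c⟩ ⟨a', b', c'⟩
  simp only [liftMiddle, of_apply, conjTranspose_apply, apply_ite star, star_zero, eq_comm]

lemma trace_liftMiddle_mul {A B C : Type*} [Fintype A] [Fintype B] [DecidableEq B] [Fintype C]
    (X : Matrix (A × C) (A × C) ℂ)
    (ρ : Matrix (A × B × C) (A × B × C) ℂ) :
    (liftMiddle B X * ρ).trace = (X * ptraceB3 ρ).trace := by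
  simp only [trace, diag, liftMiddle, ptraceB3, of_apply, Matrix.mul_apply,
    Fintype.sum_prod_type, ite_mul, zero_mul, Finset.sum_ite_irrel, Finset.sum_const_zero,
    Finset.sum_ite_eq, Finset.mem_univ, if_true, Finset.mul_sum]
  refine Finset.sum_congr rfl fun a _ => ?_
  rw [Finset.sum_comm]
  refine Finset.sum_congr rfl fun c _ => ?_
  rw [Finset.sum_comm]
  refine Finset.sum_congr rfl fun a' _ => ?_
  rw [Finset.sum_comm]

lemma resolventForm_liftMiddle {A B C : Type*} [Fintype A] [Fintype B] [DecidableEq B]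
    [Fintype C]
    (t : ℝ) (X : Matrix (A × C) (A × C) ℂ)
    (ρ σ : Matrix (A × B × C) (A × B × C) ℂ) :
    resolventForm t (liftMiddle B X) ρ σ = resolventForm t X (ptraceB3 ρ) (ptraceB3 σ) := by
  unfold resolventForm
  rw [trace_mul_comm (liftMiddle B X * ρ), trace_mul_comm (X * ptraceB3 ρ),
    trace_mul_comm _ (σ * _), trace_mul_comm _ (ptraceB3 σ * _), Matrix.mul_assoc σ,
    Matrix.mul_assoc (ptraceB3 σ), trace_mul_comm σ, trace_mul_comm (ptraceB3 σ),
    ← Matrix.mul_assoc, ← Matrix.mul_assoc, liftMiddle_conjTranspose, liftMiddle_mul,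
    liftMiddle_mul, trace_liftMiddle_mul, trace_liftMiddle_mul, trace_liftMiddle_mul]

lemma ptraceB3_one_kronecker_ptraceA {A B C : Type*} [Fintype A] [DecidableEq A] [Fintype B]
    (ρ : Matrix (A × B × C) (A × B × C) ℂ) :
    ptraceB3 ((1 : Matrix A A ℂ) ⊗ₖ ptraceA ρ) = (1 : Matrix A A ℂ) ⊗ₖ ptraceA (ptraceB3 ρ) := by
  ext ⟨a, c⟩ ⟨a', c'⟩
  simp only [ptraceB3, ptraceA, of_apply, kroneckerMap_apply]
  rw [Finset.sum_comm, Finset.mul_sum]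

lemma ptraceA_ptraceB3 {A B C : Type*} [Fintype A] [Fintype B]
    (ρ : Matrix (A × B × C) (A × B × C) ℂ) :
    ptraceA (ptraceB3 ρ) = ptraceA (ptraceA ρ) := by
  ext c c'
  simp only [ptraceB3, ptraceA, of_apply]
  rw [Finset.sum_comm]

lemma trace_ptraceB3 {A B C : Type*} [Fintype A] [Fintype B] [Fintype C]
    (ρ : Matrix (A × B × C) (A × B × C) ℂ) :
    (ptraceB3 ρ).trace = ρ.trace := by
  simp only [trace, diag, ptraceB3, of_apply, Fintype.sum_prod_type]
  exact Finset.sum_congr rfl fun _ _ => Finset.sum_comm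

lemma normSq_apply_eq {n : Type*} [Fintype n] (W : Matrix n n ℂ) (i j : n) :
    (Complex.normSq (W i j) : ℂ) = W i j * star (W i j) := by
  rw [Complex.normSq_eq_conj_mul_self, mul_comm]; rfl

lemma conjTranspose_mul_conjTranspose_mul_eq_one {n : Type*} [Fintype n] [DecidableEq n]
    {U V : Matrix n n ℂ} (hU : Uᴴ * U = 1) (hV : Vᴴ * V = 1) : (Vᴴ * U)ᴴ * (Vᴴ * U) = 1 := by
  rw [conjTranspose_mul, conjTranspose_conjTranspose, Matrix.mul_assoc, ← Matrix.mul_assoc V,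
    mul_eq_one_comm.1 hV, Matrix.one_mul, hU]

lemma sum_normSq_col {n : Type*} [Fintype n] [DecidableEq n] {W : Matrix n n ℂ}
    (hW : Wᴴ * W = 1) (i : n) : ∑ j, Complex.normSq (W j i) = 1 := by
  have h := congrFun (congrFun hW i) i
  rw [Matrix.mul_apply, one_apply_eq] at h
  rw [← Complex.ofReal_inj, Complex.ofReal_sum, Complex.ofReal_one, ← h]
  exact Finset.sum_congr rfl fun j _ => by rw [normSq_apply_eq, conjTranspose_apply, mul_comm]

/-- The squared overlaps between the eigenbasis of `ρ` and the eigenbasis of `1 ⊗ ρ_B`. -/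
noncomputable def overlap {ρ : Matrix (A × B) (A × B) ℂ} (h : ρ.IsHermitian)
    (hB : (ptraceA ρ).IsHermitian) (x : (A × B) × (A × B)) : ℝ :=
  Complex.normSq ((((1 : Matrix A A ℂ) ⊗ₖ (hB.eigenvectorUnitary : Matrix B B ℂ))ᴴ *
    (h.eigenvectorUnitary : Matrix (A × B) (A × B) ℂ)) x.1 x.2)

lemma one_kronecker_conjTranspose_mul {V : Matrix B B ℂ} (hV : Vᴴ * V = 1) :
    ((1 : Matrix A A ℂ) ⊗ₖ V)ᴴ * ((1 : Matrix A A ℂ) ⊗ₖ V) = 1 := by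
  rw [conjTranspose_kronecker, ← mul_kronecker_mul, hV, conjTranspose_one, Matrix.one_mul,
    one_kronecker_one]

lemma one_kronecker_eq {σ V : Matrix B B ℂ} {q : B → ℝ}
    (hσ : σ = V * diagonal (fun i => (q i : ℂ)) * Vᴴ) :
    (1 : Matrix A A ℂ) ⊗ₖ σ = ((1 : Matrix A A ℂ) ⊗ₖ V) *
      diagonal (fun x : A × B => (q x.2 : ℂ)) * ((1 : Matrix A A ℂ) ⊗ₖ V)ᴴ := by
  have : diagonal (fun x : A × B => (q x.2 : ℂ)) =
      (1 : Matrix A A ℂ) ⊗ₖ diagonal (fun i => (q i : ℂ)) := by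
    rw [← diagonal_one, diagonal_kronecker_diagonal]
    simp
  rw [this, conjTranspose_kronecker, ← mul_kronecker_mul, ← mul_kronecker_mul, ← hσ,
    conjTranspose_one, Matrix.one_mul, Matrix.one_mul]

section Overlap

variable {ρ : Matrix (A × B) (A × B) ℂ} (h : ρ.IsHermitian) (hB : (ptraceA ρ).IsHermitian)

lemma overlap_nonneg (x : (A × B) × (A × B)) : 0 ≤ overlap h hB x :=
  Complex.normSq_nonneg _

lemma sum_overlap_left (i : A × B) : ∑ j, overlap h hB (j, i) = 1 :=
  sum_normSq_col (conjTranspose_mul_conjTranspose_mul_eq_one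
    h.eigenvectorUnitary_conjTranspose_mul
    (one_kronecker_conjTranspose_mul hB.eigenvectorUnitary_conjTranspose_mul)) i

lemma sum_overlap_mul_eigenvalues (b : B) :
    ∑ a, ∑ i, overlap h hB ((a, b), i) * h.eigenvalues i = hB.eigenvalues b := by
  set V := (hB.eigenvectorUnitary : Matrix B B ℂ) with hV
  set W := ((1 : Matrix A A ℂ) ⊗ₖ V)ᴴ * (h.eigenvectorUnitary : Matrix (A × B) (A × B) ℂ) with hW
  have hd : W * diagonal (fun i => (h.eigenvalues i : ℂ)) * Wᴴ =
      ((1 : Matrix A A ℂ) ⊗ₖ Vᴴ) * ρ * ((1 : Matrix A A ℂ) ⊗ₖ V) := by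
    conv_rhs => rw [h.eq_eigenvectorUnitary_mul]
    rw [hW, conjTranspose_mul, conjTranspose_conjTranspose, conjTranspose_kronecker,
      conjTranspose_one]
    simp only [Matrix.mul_assoc]
  have hB' : Vᴴ * ptraceA ρ * V = diagonal (fun i => (hB.eigenvalues i : ℂ)) := by
    conv_lhs => rw [hB.eq_eigenvectorUnitary_mul]
    rw [← hV, Matrix.mul_assoc, Matrix.mul_assoc, hB.eigenvectorUnitary_conjTranspose_mul,
      ← Matrix.mul_assoc, ← Matrix.mul_assoc, hB.eigenvectorUnitary_conjTranspose_mul,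
      Matrix.one_mul, Matrix.mul_one]
  have key := congrFun (congrFun ((congrArg ptraceA hd).trans
    ((ptraceA_one_kronecker_mul_mul _ _ _).trans hB')) b) b
  rw [diagonal_apply_eq] at key
  rw [← Complex.ofReal_inj, ← key]
  simp only [ptraceA, of_apply, Complex.ofReal_sum, Complex.ofReal_mul, overlap]
  refine Finset.sum_congr rfl fun a _ => ?_
  rw [Matrix.mul_apply]
  refine Finset.sum_congr rfl fun i _ => ?_
  rw [mul_diagonal, conjTranspose_apply, normSq_apply_eq]
  change W (a, b) i * star (W (a, b) i) * _ = _
  ring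

lemma sum_overlap_mul_right (f : A × B → ℝ) :
    ∑ x : (A × B) × (A × B), overlap h hB x * f x.2 = ∑ i, f i := by
  rw [Fintype.sum_prod_type_right]
  simp only [← Finset.sum_mul, sum_overlap_left, one_mul]

lemma sum_overlap_mul_eigenvalues_mul (f : B → ℝ) :
    ∑ x : (A × B) × (A × B), overlap h hB x * h.eigenvalues x.2 * f x.1.2 =
      ∑ b, hB.eigenvalues b * f b := by
  rw [Fintype.sum_prod_type, Fintype.sum_prod_type_right]
  simp only [← Finset.sum_mul, sum_overlap_mul_eigenvalues]

lemma sum_overlap_log :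
    ∑ x : (A × B) × (A × B), overlap h hB x * h.eigenvalues x.2 *
      (Real.log (h.eigenvalues x.2) - Real.log (hB.eigenvalues x.1.2)) =
    vN (ptraceA ρ) - vN ρ := by
  simp only [mul_sub, Finset.sum_sub_distrib]
  rw [sum_overlap_mul_eigenvalues_mul h hB (fun b => Real.log (hB.eigenvalues b)), vN_eq h,
    vN_eq hB]
  simp only [mul_assoc]
  rw [sum_overlap_mul_right h hB (fun i => h.eigenvalues i * Real.log (h.eigenvalues i))]
  ring

lemma overlap_mul_eq_zero (hρ : ρ.PosSemidef) (x : (A × B) × (A × B))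
    (hx : hB.eigenvalues x.1.2 = 0) : overlap h hB x * h.eigenvalues x.2 = 0 := by
  obtain ⟨⟨a, b⟩, i⟩ := x
  have hs := sum_overlap_mul_eigenvalues h hB b
  have hnn : ∀ a i, 0 ≤ overlap h hB ((a, b), i) * h.eigenvalues i := fun a i =>
    mul_nonneg (overlap_nonneg h hB _) (hρ.eigenvalues_nonneg i)
  rw [hx, Finset.sum_eq_zero_iff_of_nonneg fun a _ => Finset.sum_nonneg fun i _ => hnn a i] at hs
  have := hs a (Finset.mem_univ _)
  rw [Finset.sum_eq_zero_iff_of_nonneg fun i _ => hnn a i] at this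
  exact this i (Finset.mem_univ _)

end Overlap

/-- Strong subadditivity of the von Neumann entropy. -/
theorem vN_strong_subadditivity {ρ : Matrix (A × B × C) (A × B × C) ℂ} (hρ : ρ.PosSemidef) :
    vN ρ + vN (ptraceA (ptraceA ρ)) ≤ vN (ptraceB3 ρ) + vN (ptraceA ρ) := by
  have hBC := posSemidef_ptraceA hρ
  have hAC := posSemidef_ptraceB3 hρ
  have hC := posSemidef_ptraceA hAC
  have hres : ∀ t : ℝ, 0 < t →
      ∑ x, overlap hAC.1 hC.1 x * (hAC.1.eigenvalues x.2 ^ 2 /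
        (hC.1.eigenvalues x.1.2 + t * hAC.1.eigenvalues x.2)) ≤
      ∑ x, overlap hρ.1 hBC.1 x * (hρ.1.eigenvalues x.2 ^ 2 /
        (hBC.1.eigenvalues x.1.2 + t * hρ.1.eigenvalues x.2)) := by
    intro t ht
    obtain ⟨X, hX⟩ := exists_resolventForm_eq hAC.1.eigenvectorUnitary_conjTranspose_mul
      (one_kronecker_conjTranspose_mul (A := A) hC.1.eigenvectorUnitary_conjTranspose_mul)
      hAC.1.eq_eigenvectorUnitary_mul (one_kronecker_eq hC.1.eq_eigenvectorUnitary_mul)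
      hAC.eigenvalues_nonneg (fun x => hC.eigenvalues_nonneg x.2) ht
    have hle := resolventForm_le hρ.1.eigenvectorUnitary_conjTranspose_mul
      (one_kronecker_conjTranspose_mul (A := A) hBC.1.eigenvectorUnitary_conjTranspose_mul)
      hρ.1.eq_eigenvectorUnitary_mul (one_kronecker_eq hBC.1.eq_eigenvectorUnitary_mul)
      hρ.eigenvalues_nonneg (fun x => hBC.eigenvalues_nonneg x.2) ht (liftMiddle B X)
    rw [resolventForm_liftMiddle, ptraceB3_one_kronecker_ptraceA, hX] at hle
    rw [Fintype.sum_prod_type (α₁ := A × C), Fintype.sum_prod_type (α₁ := A × B × C)]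
    exact hle
  have htot : ∑ x, overlap hρ.1 hBC.1 x * hρ.1.eigenvalues x.2 =
      ∑ x, overlap hAC.1 hC.1 x * hAC.1.eigenvalues x.2 := by
    rw [sum_overlap_mul_right, sum_overlap_mul_right, ← Complex.ofReal_inj, Complex.ofReal_sum,
      Complex.ofReal_sum]
    exact (hρ.1.trace_eq_sum_eigenvalues.symm.trans (trace_ptraceB3 ρ).symm).trans
      hAC.1.trace_eq_sum_eigenvalues
  have := sum_mul_log_sub_log_le (overlap hρ.1 hBC.1) (fun x => hρ.1.eigenvalues x.2)
    (fun x => hBC.1.eigenvalues x.1.2) (overlap hAC.1 hC.1) (fun x => hAC.1.eigenvalues x.2)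
    (fun x => hC.1.eigenvalues x.1.2) (fun x => hρ.eigenvalues_nonneg _)
    (fun x => hBC.eigenvalues_nonneg _) (fun x => hAC.eigenvalues_nonneg _)
    (fun x => hC.eigenvalues_nonneg _) (overlap_mul_eq_zero _ _ hρ)
    (overlap_mul_eq_zero _ _ hAC) htot hres
  rw [sum_overlap_log, sum_overlap_log, ptraceA_ptraceB3] at this
  linarith

end PartialTrace

section Purification

variable {m k : Type*} [Fintype m] [DecidableEq m] [Fintype k] [DecidableEq k]

lemma vN_eq_sum_roots {ρ : Matrix m m ℂ} (h : ρ.IsHermitian) :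
    vN ρ = -(ρ.charpoly.roots.map fun z : ℂ => z.re * Real.log z.re).sum := by
  rw [vN_eq h, h.roots_charpoly_eq_eigenvalues, Multiset.map_map]
  rfl

/-- The entropy of `ρ = M Mᴴ`, where `M` is the amplitude matrix of a pure state. -/
noncomputable def pureEntropy (M : m → k → ℂ) : ℝ := vN (of M * (of M)ᴴ)

lemma vN_mul_conjTranspose_comm (M : Matrix m k ℂ) : vN (M * Mᴴ) = vN (Mᴴ * M) := by
  rw [vN_eq_sum_roots (isHermitian_mul_conjTranspose_self M),
    vN_eq_sum_roots (isHermitian_conjTranspose_mul_self M)]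
  have h := congrArg (fun P : Polynomial ℂ => (P.roots.map fun z : ℂ => z.re * Real.log z.re).sum)
    (charpoly_mul_comm' M Mᴴ)
  have key : ∀ (r : ℕ) (P : Polynomial ℂ), P.Monic →
      ((Polynomial.X ^ r * P).roots.map fun z : ℂ => z.re * Real.log z.re).sum =
        (P.roots.map fun z : ℂ => z.re * Real.log z.re).sum := by
    intro r P hP
    rw [Polynomial.roots_mul (mul_ne_zero (pow_ne_zero _ Polynomial.X_ne_zero) hP.ne_zero)]
    simp [Multiset.map_nsmul, Multiset.sum_nsmul]
  simp only [key _ _ (charpoly_monic _)] at h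
  rw [h]

lemma vN_transpose {ρ : Matrix m m ℂ} (h : ρ.IsHermitian) : vN ρᵀ = vN ρ := by
  rw [vN_eq_sum_roots h, vN_eq_sum_roots h.transpose, charpoly_transpose]

lemma pureEntropy_swap (M : m → k → ℂ) : pureEntropy (fun y x => M x y) = pureEntropy M := by
  unfold pureEntropy
  rw [vN_mul_conjTranspose_comm (of M), ← vN_transpose (isHermitian_conjTranspose_mul_self _)]
  congr 1
  ext i j
  simp [Matrix.mul_apply, mul_comm]

lemma pureEntropy_congr {m k : Type*} [Fintype m] [DecidableEq m] [Fintype k]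
    {m' k' : Type*} [Fintype m'] [DecidableEq m'] [Fintype k']
    (e : m ≃ m') (f : k ≃ k') {M : m → k → ℂ} {N : m' → k' → ℂ}
    (h : ∀ x y, M x y = N (e x) (f y)) : pureEntropy M = pureEntropy N := by
  unfold pureEntropy
  rw [vN_eq_sum_roots (isHermitian_mul_conjTranspose_self _),
    vN_eq_sum_roots (isHermitian_mul_conjTranspose_self _),
    ← charpoly_reindex e (of M * (of M)ᴴ)]
  congr 5
  ext i j
  simp only [reindex_apply, submatrix_apply, Matrix.mul_apply, of_apply, conjTranspose_apply, h,
    Equiv.apply_symm_apply]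
  exact Equiv.sum_comp f fun y => N i y * star (N j y)

lemma pureEntropy_congr_swap {m k : Type*} [Fintype m] [DecidableEq m] [Fintype k]
    {m' k' : Type*} [Fintype m'] [DecidableEq m'] [Fintype k']
    [DecidableEq k'] (e : m ≃ m') (f : k ≃ k') {M : m → k → ℂ} {N : k' → m' → ℂ}
    (h : ∀ x y, M x y = N (f y) (e x)) : pureEntropy M = pureEntropy N :=
  (pureEntropy_congr e f h).trans (pureEntropy_swap N)

end Purification

section Tripartite

variable {A B C D : Type*} [Fintype A] [DecidableEq A] [Fintype B] [DecidableEq B] [Fintype C]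
  [DecidableEq C] [Fintype D] [DecidableEq D]

/-- Strong subadditivity for the marginals of a four-partite pure state. -/
lemma pureEntropy_strong_subadditivity {A B C D : Type*} [Fintype A] [DecidableEq A] [Fintype B]
    [DecidableEq B] [Fintype C] [DecidableEq C] [Fintype D]
    (ψ : A → B → C → D → ℂ) :
    pureEntropy (fun (x : A × B × C) (d : D) => ψ x.1 x.2.1 x.2.2 d) +
      pureEntropy (fun (c : C) (y : A × B × D) => ψ y.1 y.2.1 c y.2.2) ≤
    pureEntropy (fun (x : A × C) (y : B × D) => ψ x.1 y.1 x.2 y.2) +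
      pureEntropy (fun (x : B × C) (y : A × D) => ψ y.1 x.1 x.2 y.2) := by
  convert vN_strong_subadditivity (posSemidef_self_mul_conjTranspose
    (of fun (x : A × B × C) (d : D) => ψ x.1 x.2.1 x.2.2 d)) using 2
  all_goals
    unfold pureEntropy
    congr 1
  · ext i j
    simp only [ptraceA, Matrix.mul_apply, of_apply, Fintype.sum_prod_type, conjTranspose_apply]
    exact Finset.sum_comm
  · ext i j
    simp [ptraceB3, Matrix.mul_apply, Fintype.sum_prod_type]
  · ext i j
    simp [ptraceA, Matrix.mul_apply, Fintype.sum_prod_type]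

/-- The averaged form of the two versions of strong subadditivity. -/
lemma pureEntropy_average (ψ : A → B → C → D → ℂ) :
    pureEntropy (fun (x : A × B × C) (d : D) => ψ x.1 x.2.1 x.2.2 d) +
      pureEntropy (fun (c : C) (y : A × B × D) => ψ y.1 y.2.1 c y.2.2) +
      pureEntropy (fun (a : A) (y : B × C × D) => ψ a y.1 y.2.1 y.2.2) +
      pureEntropy (fun (b : B) (y : A × C × D) => ψ y.1 b y.2.1 y.2.2) ≤
    pureEntropy (fun (x : A × C) (y : B × D) => ψ x.1 y.1 x.2 y.2) +
      pureEntropy (fun (x : B × C) (y : A × D) => ψ y.1 x.1 x.2 y.2) +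
      2 * pureEntropy (fun (x : A × B) (y : C × D) => ψ x.1 x.2 y.1 y.2) := by
  have hA := pureEntropy_strong_subadditivity fun b c a d => ψ a b c d
  have hB := pureEntropy_strong_subadditivity fun a c b d => ψ a b c d
  have hA' := pureEntropy_strong_subadditivity fun b d a c => ψ a b c d
  have hB' := pureEntropy_strong_subadditivity fun a d b c => ψ a b c d
  have eABC₁ : pureEntropy (fun (x : B × C × A) (d : D) => ψ x.2.2 x.1 x.2.1 d) =
      pureEntropy (fun (x : A × B × C) (d : D) => ψ x.1 x.2.1 x.2.2 d) :=
    pureEntropy_congr ⟨fun x => (x.2.2, x.1, x.2.1), fun x => (x.2.1, x.2.2, x.1),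
      fun _ => rfl, fun _ => rfl⟩ (Equiv.refl _) fun _ _ => rfl
  have eABC₂ : pureEntropy (fun (x : A × C × B) (d : D) => ψ x.1 x.2.2 x.2.1 d) =
      pureEntropy (fun (x : A × B × C) (d : D) => ψ x.1 x.2.1 x.2.2 d) :=
    pureEntropy_congr ⟨fun x => (x.1, x.2.2, x.2.1), fun x => (x.1, x.2.2, x.2.1),
      fun _ => rfl, fun _ => rfl⟩ (Equiv.refl _) fun _ _ => rfl
  have eAB : pureEntropy (fun (x : B × A) (y : C × D) => ψ x.2 x.1 y.1 y.2) =
      pureEntropy (fun (x : A × B) (y : C × D) => ψ x.1 x.2 y.1 y.2) :=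
    pureEntropy_congr (Equiv.prodComm _ _) (Equiv.refl _) fun _ _ => rfl
  have eAB₁ : pureEntropy (fun (x : B × A) (y : D × C) => ψ x.2 x.1 y.2 y.1) =
      pureEntropy (fun (x : A × B) (y : C × D) => ψ x.1 x.2 y.1 y.2) :=
    pureEntropy_congr (Equiv.prodComm _ _) (Equiv.prodComm _ _) fun _ _ => rfl
  have eAB₂ : pureEntropy (fun (x : A × B) (y : D × C) => ψ x.1 x.2 y.2 y.1) =
      pureEntropy (fun (x : A × B) (y : C × D) => ψ x.1 x.2 y.1 y.2) :=
    pureEntropy_congr (Equiv.refl _) (Equiv.prodComm _ _) fun _ _ => rfl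
  have eAC : pureEntropy (fun (x : C × A) (y : B × D) => ψ x.2 y.1 x.1 y.2) =
      pureEntropy (fun (x : A × C) (y : B × D) => ψ x.1 y.1 x.2 y.2) :=
    pureEntropy_congr (Equiv.prodComm _ _) (Equiv.refl _) fun _ _ => rfl
  have eAC' : pureEntropy (fun (x : D × B) (y : A × C) => ψ y.1 x.2 y.2 x.1) =
      pureEntropy (fun (x : A × C) (y : B × D) => ψ x.1 y.1 x.2 y.2) :=
    pureEntropy_congr_swap (Equiv.prodComm _ _) (Equiv.refl _) fun _ _ => rfl
  have eBC : pureEntropy (fun (x : C × B) (y : A × D) => ψ y.1 x.2 x.1 y.2) =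
      pureEntropy (fun (x : B × C) (y : A × D) => ψ y.1 x.1 x.2 y.2) :=
    pureEntropy_congr (Equiv.prodComm _ _) (Equiv.refl _) fun _ _ => rfl
  have eBC' : pureEntropy (fun (x : D × A) (y : B × C) => ψ x.2 y.1 y.2 x.1) =
      pureEntropy (fun (x : B × C) (y : A × D) => ψ y.1 x.1 x.2 y.2) :=
    pureEntropy_congr_swap (Equiv.prodComm _ _) (Equiv.refl _) fun _ _ => rfl
  have eA : pureEntropy (fun (a : A) (y : B × D × C) => ψ a y.1 y.2.2 y.2.1) =
      pureEntropy (fun (a : A) (y : B × C × D) => ψ a y.1 y.2.1 y.2.2) :=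
    pureEntropy_congr (Equiv.refl _) ⟨fun x => (x.1, x.2.2, x.2.1), fun x => (x.1, x.2.2, x.2.1),
      fun _ => rfl, fun _ => rfl⟩ fun _ _ => rfl
  have eB : pureEntropy (fun (b : B) (y : A × D × C) => ψ y.1 b y.2.2 y.2.1) =
      pureEntropy (fun (b : B) (y : A × C × D) => ψ y.1 b y.2.1 y.2.2) :=
    pureEntropy_congr (Equiv.refl _) ⟨fun x => (x.1, x.2.2, x.2.1), fun x => (x.1, x.2.2, x.2.1),
      fun _ => rfl, fun _ => rfl⟩ fun _ _ => rfl
  have eC₁ : pureEntropy (fun (x : B × D × A) (c : C) => ψ x.2.2 x.1 c x.2.1) =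
      pureEntropy (fun (c : C) (y : A × B × D) => ψ y.1 y.2.1 c y.2.2) :=
    pureEntropy_congr_swap ⟨fun x => (x.2.2, x.1, x.2.1), fun x => (x.2.1, x.2.2, x.1),
      fun _ => rfl, fun _ => rfl⟩ (Equiv.refl _) fun _ _ => rfl
  have eC₂ : pureEntropy (fun (x : A × D × B) (c : C) => ψ x.1 x.2.2 c x.2.1) =
      pureEntropy (fun (c : C) (y : A × B × D) => ψ y.1 y.2.1 c y.2.2) :=
    pureEntropy_congr_swap ⟨fun x => (x.1, x.2.2, x.2.1), fun x => (x.1, x.2.2, x.2.1),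
      fun _ => rfl, fun _ => rfl⟩ (Equiv.refl _) fun _ _ => rfl
  linarith

end Tripartite

/-- for any tripartite density matrix `ρ_ABC`,
`I(A:B|C) ≥ S(ρ_A) + S(ρ_B) − 2 S(ρ_AB) = I(A:B) − S(ρ_AB)`. -/
theorem cmi_ge_mutual_info_minus_entropy
    (dA dB dC : ℕ)
    (ρ : Matrix (Fin dA × Fin dB × Fin dC) (Fin dA × Fin dB × Fin dC) ℂ)
    (hρ : ρ.PosSemidef) (htr : ρ.trace = 1) :
    condMutualInfo ρ ≥
      vN (ptraceB ρ) + vN (ptraceB (ptraceA ρ)) - 2 * vN (ptraceC3 ρ) ∧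
    vN (ptraceB ρ) + vN (ptraceB (ptraceA ρ)) - 2 * vN (ptraceC3 ρ)
      = mutualInfo (ptraceC3 ρ) - vN (ptraceC3 ρ) := by
  have hA : ptraceB (ptraceC3 ρ) = ptraceB ρ := by
    ext i j
    simp [ptraceB, ptraceC3, Fintype.sum_prod_type]
  have hB : ptraceA (ptraceC3 ρ) = ptraceB (ptraceA ρ) := by
    ext i j
    simp only [ptraceA, ptraceB, ptraceC3, of_apply]
    exact Finset.sum_comm
  refine ⟨?_, by rw [mutualInfo, hA, hB]; ring⟩
  obtain ⟨M, hM⟩ : ∃ M : Matrix (Fin dA × Fin dB × Fin dC) (Fin dA × Fin dB × Fin dC) ℂ,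
      ρ = M * Mᴴ := by
    open scoped MatrixOrder Matrix.Norms.L2Operator in
    obtain ⟨N, hN⟩ := CStarAlgebra.nonneg_iff_eq_star_mul_self.1 hρ.nonneg
    exact ⟨Nᴴ, by rw [conjTranspose_conjTranspose]; exact hN⟩
  have key := pureEntropy_average fun a b c d => M (a, b, c) d
  have eABC : vN ρ = pureEntropy
      (fun (x : Fin dA × Fin dB × Fin dC) d => M (x.1, x.2.1, x.2.2) d) :=
    congrArg vN hM
  have eBC : vN (ptraceA ρ) = pureEntropy (fun (x : Fin dB × Fin dC)
      (y : Fin dA × Fin dA × Fin dB × Fin dC) => M (y.1, x.1, x.2) y.2) := by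
    refine congrArg vN (Matrix.ext fun i j => ?_)
    simp [hM, ptraceA, Matrix.mul_apply, Fintype.sum_prod_type]
  have eAC : vN (ptraceB3 ρ) = pureEntropy (fun (x : Fin dA × Fin dC)
      (y : Fin dB × Fin dA × Fin dB × Fin dC) => M (x.1, y.1, x.2) y.2) := by
    refine congrArg vN (Matrix.ext fun i j => ?_)
    simp [hM, ptraceB3, Matrix.mul_apply, Fintype.sum_prod_type]
  have eAB : vN (ptraceC3 ρ) = pureEntropy (fun (x : Fin dA × Fin dB)
      (y : Fin dC × Fin dA × Fin dB × Fin dC) => M (x.1, x.2, y.1) y.2) := by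
    refine congrArg vN (Matrix.ext fun i j => ?_)
    simp [hM, ptraceC3, Matrix.mul_apply, Fintype.sum_prod_type]
  have eA : vN (ptraceB ρ) = pureEntropy (fun (a : Fin dA)
      (y : Fin dB × Fin dC × Fin dA × Fin dB × Fin dC) => M (a, y.1, y.2.1) y.2.2) := by
    refine congrArg vN (Matrix.ext fun i j => ?_)
    simp [hM, ptraceB, Matrix.mul_apply, Fintype.sum_prod_type]
  have eB : vN (ptraceB (ptraceA ρ)) = pureEntropy (fun (b : Fin dB)
      (y : Fin dA × Fin dC × Fin dA × Fin dB × Fin dC) => M (y.1, b, y.2.1) y.2.2) := by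
    refine congrArg vN (Matrix.ext fun i j => ?_)
    simp only [hM, ptraceA, ptraceB, of_apply, Matrix.mul_apply, Fintype.sum_prod_type,
      conjTranspose_apply]
    exact Finset.sum_comm
  have eC : vN (ptraceA (ptraceA ρ)) = pureEntropy (fun (c : Fin dC)
      (y : Fin dA × Fin dB × Fin dA × Fin dB × Fin dC) => M (y.1, y.2.1, c) y.2.2) := by
    refine congrArg vN (Matrix.ext fun i j => ?_)
    simp only [hM, ptraceA, of_apply, Matrix.mul_apply, Fintype.sum_prod_type,
      conjTranspose_apply]
    exact Finset.sum_comm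
  rw [condMutualInfo, eABC, eBC, eAC, eAB, eA, eB, eC]
  linarith
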